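/- For noncrossing matchings a of type (n-k,k) and b ∈ B_a^{n-k,k}, the distance d(a,b) equals (n−k) − |aw(b)|, where |aw(b)| counts the connected components (circles and lines) of the glued one-manifold aw(b). -/

import Mathlib

/-- A noncrossing matching of type `(n-k, k)`: `k` pairwise-noncrossing arcs above a
horizontal line of `n` vertices (labelled `1,…,n`); the remaining `n-2k` vertices carry
rays, and no ray lies beneath an arc (every vertex strictly between the endpoints of an
arc is an endpoint of some arc). -/
structure NCMatching (n k : ℕ) where
  arcs : Finset (ℕ × ℕ)
  card_arcs : arcs.card = k
  mem_range : ∀ p ∈ arcs, 1 ≤ p.1 ∧ p.1 < p.2 ∧ p.2 ≤ n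
  endpoints_distinct : ∀ p ∈ arcs, ∀ q ∈ arcs, p ≠ q →
    p.1 ≠ q.1 ∧ p.1 ≠ q.2 ∧ p.2 ≠ q.1 ∧ p.2 ≠ q.2
  noncross : ∀ p ∈ arcs, ∀ q ∈ arcs, ¬ (p.1 < q.1 ∧ q.1 < p.2 ∧ p.2 < q.2)
  no_ray_under : ∀ p ∈ arcs, ∀ r, p.1 < r → r < p.2 → ∃ q ∈ arcs, r = q.1 ∨ r = q.2

/-- Vertex `i` carries a ray of the matching `m`. -/
def NCMatching.IsRay {n k : ℕ} (m : NCMatching n k) (i : ℕ) : Prop :=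
  1 ≤ i ∧ i ≤ n ∧ ∀ p ∈ m.arcs, p.1 ≠ i ∧ p.2 ≠ i

/-- The adjacency relation on vertices coming from the glued one-manifold `a w(b)`:
two vertices are related if an arc of `a` or an arc of (the reflection of) `b` joins them. -/
def glueRel {n k : ℕ} (a b : NCMatching n k) (i j : ℕ) : Prop :=
  (i, j) ∈ a.arcs ∨ (j, i) ∈ a.arcs ∨ (i, j) ∈ b.arcs ∨ (j, i) ∈ b.arcs

/-- Two vertices lie on the same connected component of `a w(b)`. -/
def Conn {n k : ℕ} (a b : NCMatching n k) : ℕ → ℕ → Prop :=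
  Relation.ReflTransGen (glueRel a b)

/-- The glue relation transported to `Fin n` (the vertex `i : Fin n` has label `i+1`). -/
def glueRelF {n k : ℕ} (a b : NCMatching n k) (i j : Fin n) : Prop :=
  glueRel a b ((i : ℕ) + 1) ((j : ℕ) + 1)

/-- `comps a b = |a w(b)|`, the number of connected components (circles and line
segments) of the glued one-manifold `a w(b)`. -/
noncomputable def comps {n k : ℕ} (a b : NCMatching n k) : ℕ :=
  Nat.card (Quot (glueRelF a b))

/-- The elementary move `a → b`: either two unnested arcs `(i,j), (l,m)` of `a` are replaced
by the nested arcs `(i,m), (j,l)` on the same four vertices, or an arc-ray pair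
`(i), (j,l)` with `i<j<l` is replaced by `(i,j), (l)`; the matchings agree elsewhere. -/
def Move {n k : ℕ} (a b : NCMatching n k) : Prop :=
  (∃ i j l m : ℕ, i < j ∧ j < l ∧ l < m ∧ (i, j) ∈ a.arcs ∧ (l, m) ∈ a.arcs ∧
    b.arcs = insert (i, m) (insert (j, l) ((a.arcs.erase (i, j)).erase (l, m)))) ∨
  (∃ i j l : ℕ, i < j ∧ j < l ∧ a.IsRay i ∧ (j, l) ∈ a.arcs ∧
    b.arcs = insert (i, j) (a.arcs.erase (j, l)))

/-- A sequence of matchings in which each consecutive pair is related by `→` or `←`. -/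
def IsMoveSeq {n k d : ℕ} (f : Fin (d + 1) → NCMatching n k) : Prop :=
  ∀ i : Fin d, Move (f i.castSucc) (f i.succ) ∨ Move (f i.succ) (f i.castSucc)

/-- The distance `d(a,b)`: the minimal number of moves `→` or `←` needed to go from `a` to `b`. -/
noncomputable def mdist {n k : ℕ} (a b : NCMatching n k) : ℕ :=
  sInf {d : ℕ | ∃ f : Fin (d + 1) → NCMatching n k,
    f 0 = a ∧ f (Fin.last d) = b ∧ IsMoveSeq f}

/-- `b ∈ B_a^{n-k,k}`: every line segment of `a w(b)` has endpoints pointing in opposite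
directions, i.e. no component of `a w(b)` contains two distinct rays of `a`, nor two
distinct rays of `b`. -/
def InBa {n k : ℕ} (a b : NCMatching n k) : Prop :=
  (∀ i j, a.IsRay i → a.IsRay j → i ≠ j → ¬ Conn a b i j) ∧
  (∀ i j, b.IsRay i → b.IsRay j → i ≠ j → ¬ Conn a b i j)

section Quotients

variable {V : Type*} [Finite V]

theorem card_quot_le_of_refines {r s : V → V → Prop}
    (h : ∀ i j, r i j → Quot.mk s i = Quot.mk s j) :
    Nat.card (Quot s) ≤ Nat.card (Quot r) := by
  refine Nat.card_le_card_of_surjective (Quot.lift (Quot.mk s) h) ?_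
  rintro ⟨i⟩
  exact ⟨Quot.mk r i, rfl⟩

theorem card_quot_lt_of_refines {r s : V → V → Prop}
    (h : ∀ i j, r i j → Quot.mk s i = Quot.mk s j) {u v : V}
    (hs : Quot.mk s u = Quot.mk s v) (hr : Quot.mk r u ≠ Quot.mk r v) :
    Nat.card (Quot s) < Nat.card (Quot r) := by
  refine lt_of_le_of_ne (card_quot_le_of_refines h) fun heq => hr ?_
  have hsurj : Function.Surjective (Quot.lift (Quot.mk s) h) := by
    rintro ⟨i⟩
    exact ⟨Quot.mk r i, rfl⟩
  exact ((Nat.bijective_iff_surjective_and_card _).2 ⟨hsurj, heq.symm⟩).1 hs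

/-- Adding one edge to a relation merges at most two classes. -/
theorem card_quot_le_card_quot_add_edge (r : V → V → Prop) (u v : V) :
    Nat.card (Quot r) ≤ Nat.card (Quot fun i j => r i j ∨ (i = u ∧ j = v)) + 1 := by
  classical
  set s : V → V → Prop := fun i j => r i j ∨ (i = u ∧ j = v)
  let F : Quot s → Quot r := Quot.lift
    (fun i => if Quot.mk r i = Quot.mk r u then Quot.mk r v else Quot.mk r i) (by
      rintro i j (h | ⟨rfl, rfl⟩)
      · simp only [Quot.sound h]
      · simp)
  let g : Quot r → Quot s := Quot.map id fun i j h => Or.inl h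
  have hF : ∀ x, x ≠ Quot.mk r u → F (g x) = x := by
    rintro ⟨i⟩ hx
    exact if_neg hx
  let G : Quot r → Option (Quot s) := fun x => if x = Quot.mk r u then none else some (g x)
  have hG : Function.Injective G := by
    intro x y hxy
    by_cases hx : x = Quot.mk r u <;> by_cases hy : y = Quot.mk r u <;> simp [G, hx, hy] at hxy ⊢
    rw [← hF x hx, hxy, hF y hy]
  simpa [Finite.card_option] using Nat.card_le_card_of_injective G hG

end Quotients

theorem glueRel_symm {n k : ℕ} {a b : NCMatching n k} {i j : ℕ} (h : glueRel a b i j) :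
    glueRel a b j i := by
  unfold glueRel at *
  tauto

theorem Conn.symm {n k : ℕ} {a b : NCMatching n k} {i j : ℕ} (h : Conn a b i j) :
    Conn a b j i :=
  by
  induction h with
  | refl => exact .refl
  | tail _ h ih => exact .head (glueRel_symm h) ih

theorem conn_of_left {n k : ℕ} {a b : NCMatching n k} {i j : ℕ} (h : (i, j) ∈ a.arcs) :
    Conn a b i j :=
  .single (Or.inl h)

theorem conn_of_right {n k : ℕ} {a b : NCMatching n k} {i j : ℕ} (h : (i, j) ∈ b.arcs) :
    Conn a b i j :=
  .single (Or.inr (Or.inr (Or.inl h)))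

theorem glueRel_range {n k : ℕ} {a b : NCMatching n k} {i j : ℕ} (h : glueRel a b i j) :
    1 ≤ j ∧ j ≤ n := by
  rcases h with h | h | h | h
  · have := a.mem_range _ h; grind
  · have := a.mem_range _ h; grind
  · have := b.mem_range _ h; grind
  · have := b.mem_range _ h; grind

theorem quot_mk_eq_of_conn {n k : ℕ} {a b : NCMatching n k} {u v : Fin n}
    (h : Conn a b (u + 1) (v + 1)) : Quot.mk (glueRelF a b) u = Quot.mk (glueRelF a b) v := by
  suffices ∀ j, Conn a b (u + 1) j → ∃ w : Fin n, j = w + 1 ∧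
      Quot.mk (glueRelF a b) u = Quot.mk (glueRelF a b) w by
    obtain ⟨w, hw, e⟩ := this _ h
    rw [e, Fin.ext (show (v : ℕ) = w by omega)]
  intro j hj
  induction hj with
  | refl => exact ⟨u, rfl, rfl⟩
  | tail _ hbc ih =>
    obtain ⟨w, rfl, e⟩ := ih
    obtain ⟨h1, h2⟩ := glueRel_range hbc
    rename_i c _
    refine ⟨⟨c - 1, by omega⟩, by simp; omega, e.trans (Quot.sound ?_)⟩
    have : c - 1 + 1 = c := by omega
    simpa [glueRelF, this] using hbc

/-- The relation on vertices `1, …, n` (transported to `Fin n`) given by a set of edges. -/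
def edgeRel (n : ℕ) (S : Finset (ℕ × ℕ)) (i j : Fin n) : Prop :=
  ((i : ℕ) + 1, (j : ℕ) + 1) ∈ S

theorem le_card_quot_edgeRel (n : ℕ) (S : Finset (ℕ × ℕ)) :
    n ≤ Nat.card (Quot (edgeRel n S)) + S.card := by
  classical
  induction S using Finset.induction_on with
  | empty =>
    have hinj : Function.Injective (Quot.mk (edgeRel n ∅)) := fun u v h =>
      congrArg (Quot.lift id fun _ _ h => absurd h (Finset.notMem_empty _)) h
    simpa using Nat.card_le_card_of_injective _ hinj
  | insert e S he ih =>
    rw [Finset.card_insert_of_notMem he]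
    by_cases hex : ∃ u v : Fin n, e = ((u : ℕ) + 1, (v : ℕ) + 1)
    · obtain ⟨u, v, rfl⟩ := hex
      have h1 := card_quot_le_card_quot_add_edge (edgeRel n S) u v
      have h2 : (fun i j => edgeRel n S i j ∨ (i = u ∧ j = v)) =
          edgeRel n (insert ((u : ℕ) + 1, (v : ℕ) + 1) S) := by
        funext i j
        simp [edgeRel, Fin.ext_iff, or_comm]
      rw [h2] at h1
      omega
    · push Not at hex
      have h2 : edgeRel n (insert e S) = edgeRel n S := by
        funext i j
        simp [edgeRel, (hex i j).symm]
      rw [h2]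
      omega

theorem le_comps_self {n k : ℕ} (a : NCMatching n k) : n ≤ comps a a + k := by
  have h := le_card_quot_edgeRel n a.arcs
  rw [a.card_arcs] at h
  refine h.trans (Nat.add_le_add_right (card_quot_le_of_refines fun i j hij => ?_) _)
  rcases hij with hij | hij | hij | hij
  exacts [Quot.sound hij, (Quot.sound hij).symm, Quot.sound hij, (Quot.sound hij).symm]

theorem comps_add_le {n k : ℕ} (a b : NCMatching n k) : comps a b + k ≤ n := by
  classical
  let R : Finset ℕ := a.arcs.image Prod.snd
  have hR : R.card = k := by
    rw [Finset.card_image_of_injOn, a.card_arcs]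
    intro p hp q hq h
    by_contra hne
    exact (a.endpoints_distinct p hp q hq hne).2.2.2 h
  have hsub : R ⊆ Finset.Icc 1 n := by
    intro i hi
    obtain ⟨p, hp, rfl⟩ := Finset.mem_image.1 hi
    have := a.mem_range p hp
    simp
    omega
  have hcard : (Finset.Icc 1 n \ R).card + k = n := by
    have := Finset.card_sdiff_add_card_eq_card hsub
    rw [hR, Nat.card_Icc] at this
    omega
  have hmem : ∀ x : ↥(Finset.Icc 1 n \ R), 1 ≤ (x : ℕ) ∧ (x : ℕ) ≤ n := fun x =>
    Finset.mem_Icc.1 (Finset.mem_sdiff.1 x.2).1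
  let f : ↥(Finset.Icc 1 n \ R) → Quot (glueRelF a b) := fun x =>
    Quot.mk _ ⟨x - 1, by have := hmem x; omega⟩
  have hf : Function.Surjective f := by
    rintro ⟨u⟩
    by_cases hu : (u : ℕ) + 1 ∈ R
    · obtain ⟨⟨i, j⟩, hp, hj⟩ := Finset.mem_image.1 hu
      simp only at hj
      subst hj
      have h1 := a.mem_range _ hp
      simp only at h1
      have hi : i ∉ R := by
        intro hi
        obtain ⟨⟨i', j'⟩, hq, e⟩ := Finset.mem_image.1 hi
        have h3 := a.endpoints_distinct _ hp _ hq
        grind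
      refine ⟨⟨i, by simp [hi]; omega⟩, quot_mk_eq_of_conn (conn_of_left ?_)⟩
      have : i - 1 + 1 = i := by omega
      simpa [this] using hp
    · exact ⟨⟨u + 1, Finset.mem_sdiff.2 ⟨Finset.mem_Icc.2 (by omega), hu⟩⟩, by simp [f]⟩
  have := Nat.card_le_card_of_surjective f hf
  rw [Nat.card_eq_fintype_card (α := ↥(Finset.Icc 1 n \ R)), Fintype.card_coe] at this
  unfold comps
  omega

/-- If the edges of `b` become redundant once one edge is added to `a`, then gluing with `b`
gives at least as many components as gluing with `a`, up to one. -/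
theorem comps_le_comps_add_one {n k : ℕ} (c a b : NCMatching n k) (u v : Fin n)
    (h : ∀ i j : Fin n, ((i : ℕ) + 1, (j : ℕ) + 1) ∈ b.arcs →
      Quot.mk (fun i j => glueRelF c a i j ∨ (i = u ∧ j = v)) i =
        Quot.mk (fun i j => glueRelF c a i j ∨ (i = u ∧ j = v)) j) :
    comps c a ≤ comps c b + 1 := by
  refine (card_quot_le_card_quot_add_edge (glueRelF c a) u v).trans
    (Nat.add_le_add_right (card_quot_le_of_refines fun i j hij => ?_) _)
  have hc : ∀ x y, glueRelF c a x y →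
      Quot.mk (fun i j => glueRelF c a i j ∨ (i = u ∧ j = v)) x =
        Quot.mk (fun i j => glueRelF c a i j ∨ (i = u ∧ j = v)) y := fun x y hxy =>
    Quot.sound (Or.inl hxy)
  rcases hij with hij | hij | hij | hij
  exacts [hc _ _ (Or.inl hij), (hc _ _ (Or.inl hij)).symm, h _ _ hij, (h _ _ hij).symm]

theorem comps_le_of_move {n k : ℕ} (c : NCMatching n k) {a b : NCMatching n k} (h : Move a b) :
    comps c a ≤ comps c b + 1 ∧ comps c b ≤ comps c a + 1 := by
  have lift : ∀ i, 1 ≤ i ∧ i ≤ n → ∃ u : Fin n, i = u + 1 := fun i hi =>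
    ⟨⟨i - 1, by omega⟩, by simp; omega⟩
  have inst : ∀ (d : NCMatching n k) (u v x y : Fin n), ((x : ℕ) + 1, (y : ℕ) + 1) ∈ d.arcs →
      Quot.mk (fun i j => glueRelF c d i j ∨ (i = u ∧ j = v)) x =
        Quot.mk (fun i j => glueRelF c d i j ∨ (i = u ∧ j = v)) y := fun d u v x y hd =>
    Quot.sound (Or.inl (Or.inr (Or.inr (Or.inl hd))))
  have edge : ∀ (d : NCMatching n k) (u v : Fin n),
      Quot.mk (fun i j => glueRelF c d i j ∨ (i = u ∧ j = v)) u =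
        Quot.mk (fun i j => glueRelF c d i j ∨ (i = u ∧ j = v)) v := fun d u v =>
    Quot.sound (Or.inr ⟨rfl, rfl⟩)
  rcases h with ⟨i, j, l, m, hij, hjl, hlm, h1, h2, hb⟩ | ⟨i, j, l, hij, hjl, hi, h2, hb⟩
  · have r1 := a.mem_range _ h1
    have r2 := a.mem_range _ h2
    simp only at r1 r2
    obtain ⟨i, rfl⟩ := lift i (by omega)
    obtain ⟨j, rfl⟩ := lift j (by omega)
    obtain ⟨l, rfl⟩ := lift l (by omega)
    obtain ⟨m, rfl⟩ := lift m (by omega)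
    constructor
    · refine comps_le_comps_add_one c a b i m fun x y hxy => ?_
      rw [hb] at hxy
      have e1 := inst a i m _ _ h1
      have e2 := inst a i m _ _ h2
      have e3 := edge a i m
      simp only [Finset.mem_insert, Finset.mem_erase, Prod.mk.injEq, add_left_inj,
        Fin.val_inj] at hxy
      rcases hxy with ⟨rfl, rfl⟩ | ⟨rfl, rfl⟩ | ⟨-, -, h⟩
      · exact e3
      · exact e1.symm.trans (e3.trans e2.symm)
      · exact inst a i m _ _ h
    · refine comps_le_comps_add_one c b a i j fun x y hxy => ?_
      have e1 := inst b i j i m (by simp [hb])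
      have e2 := inst b i j j l (by simp [hb])
      have e3 := edge b i j
      by_cases hx1 : x = i ∧ y = j
      · rw [hx1.1, hx1.2]; exact e3
      by_cases hx2 : x = l ∧ y = m
      · rw [hx2.1, hx2.2]; exact e2.symm.trans (e3.symm.trans e1)
      refine inst b i j _ _ ?_
      simp only [hb, Finset.mem_insert, Finset.mem_erase, ne_eq, Prod.mk.injEq, add_left_inj,
        Fin.val_inj]
      tauto
  · have r2 := a.mem_range _ h2
    have r1 := hi.1
    simp only at r2
    obtain ⟨i, rfl⟩ := lift i (by omega)
    obtain ⟨j, rfl⟩ := lift j (by omega)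
    obtain ⟨l, rfl⟩ := lift l (by omega)
    constructor
    · refine comps_le_comps_add_one c a b i j fun x y hxy => ?_
      rw [hb] at hxy
      simp only [Finset.mem_insert, Finset.mem_erase, Prod.mk.injEq, add_left_inj,
        Fin.val_inj] at hxy
      rcases hxy with ⟨rfl, rfl⟩ | ⟨-, h⟩
      · exact edge a x y
      · exact inst a i j _ _ h
    · refine comps_le_comps_add_one c b a j l fun x y hxy => ?_
      by_cases hx1 : x = j ∧ y = l
      · rw [hx1.1, hx1.2]; exact edge b j l
      refine inst b j l _ _ ?_
      simp only [hb, Finset.mem_insert, Finset.mem_erase, ne_eq, Prod.mk.injEq, add_left_inj,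
        Fin.val_inj]
      tauto

theorem le_add_comps_of_isMoveSeq {n k d : ℕ} {f : Fin (d + 1) → NCMatching n k}
    (hf : IsMoveSeq f) : n ≤ d + comps (f 0) (f (Fin.last d)) + k := by
  suffices ∀ i : Fin (d + 1), n ≤ i + comps (f 0) (f i) + k by simpa using this (Fin.last d)
  intro i
  induction i using Fin.induction with
  | zero => simpa using le_comps_self (f 0)
  | succ i ih =>
    have h : comps (f 0) (f i.castSucc) ≤ comps (f 0) (f i.succ) + 1 :=
      (hf i).elim (fun h => (comps_le_of_move _ h).1) fun h => (comps_le_of_move _ h).2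
    simp only [Fin.val_castSucc, Fin.val_succ] at ih ⊢
    omega

/-- Two arcs `f, g` may be exchanged for two arcs `(p, q), (s, t)` on the same four vertices if
the latter cross nothing and no ray lies beneath them. -/
theorem exists_exchange_arcs {n k : ℕ} (a : NCMatching n k) {p q s t : ℕ} {f g : ℕ × ℕ}
    (hf : f ∈ a.arcs) (hg : g ∈ a.arcs) (hfg : f ≠ g) (hpq : p < q) (hst : s < t)
    (hne : p ≠ s ∧ p ≠ t ∧ q ≠ s ∧ q ≠ t) (hnot : (p, q) ≠ f ∧ (p, q) ≠ g ∧ (s, t) ≠ f ∧ (s, t) ≠ g)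
    (hend : ∀ r, (r = p ∨ r = q ∨ r = s ∨ r = t) ↔ (r = f.1 ∨ r = f.2 ∨ r = g.1 ∨ r = g.2))
    (hsep : (s < p ∧ q < t) ∨ t < p ∨ q < s)
    (hpq' : ∀ e ∈ a.arcs, e ≠ f → e ≠ g → (p < e.1 ∧ e.1 < q ↔ p < e.2 ∧ e.2 < q))
    (hst' : ∀ e ∈ a.arcs, e ≠ f → e ≠ g → (s < e.1 ∧ e.1 < t ↔ s < e.2 ∧ e.2 < t))
    (cpq : ∀ r, p < r → r < q → ∃ e ∈ a.arcs, r = e.1 ∨ r = e.2)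
    (cst : ∀ r, s < r → r < t → ∃ e ∈ a.arcs, r = e.1 ∨ r = e.2) :
    ∃ a' : NCMatching n k, a'.arcs = insert (p, q) (insert (s, t) ((a.arcs.erase f).erase g)) ∧
      a.arcs = insert f (insert g ((a'.arcs.erase (p, q)).erase (s, t))) ∧
      ∀ i, a'.IsRay i → a.IsRay i := by
  have hd := a.endpoints_distinct
  have h1 : (p, q) ∉ a.arcs := by
    intro h
    have := hd _ h _ hf
    have := hd _ h _ hg
    have := hend p
    grind
  have h2 : (s, t) ∉ a.arcs := by
    intro h
    have := hd _ h _ hf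
    have := hd _ h _ hg
    have := hend s
    grind
  have hold : ∀ e ∈ a.arcs, e ≠ f → e ≠ g → ∀ r, (r = p ∨ r = q ∨ r = s ∨ r = t) →
      e.1 ≠ r ∧ e.2 ≠ r := by
    intro e he hef heg r hr
    have := hd _ he _ hf hef
    have := hd _ he _ hg heg
    have := (hend r).1 hr
    grind
  have hrange : ∀ r, (r = p ∨ r = q ∨ r = s ∨ r = t) → 1 ≤ r ∧ r ≤ n := by
    intro r hr
    have := a.mem_range _ hf
    have := a.mem_range _ hg
    have := (hend r).1 hr
    grind
  let S := insert (p, q) (insert (s, t) ((a.arcs.erase f).erase g))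
  have hmem : ∀ e, e ∈ S ↔ e = (p, q) ∨ e = (s, t) ∨ (e ∈ a.arcs ∧ e ≠ f ∧ e ≠ g) := by
    intro e
    simp only [S, Finset.mem_insert, Finset.mem_erase]
    tauto
  have hcov : ∀ r, (∃ e ∈ a.arcs, r = e.1 ∨ r = e.2) → ∃ e ∈ S, r = e.1 ∨ r = e.2 := by
    rintro r ⟨e, he, hr⟩
    by_cases h : r = p ∨ r = q ∨ r = s ∨ r = t
    · rcases h with h | h | h | h
      exacts [⟨(p, q), by simp [hmem], .inl h⟩, ⟨(p, q), by simp [hmem], .inr h⟩,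
        ⟨(s, t), by simp [hmem], .inl h⟩, ⟨(s, t), by simp [hmem], .inr h⟩]
    · refine ⟨e, (hmem e).2 (.inr (.inr ⟨he, ?_, ?_⟩)), hr⟩ <;> rintro rfl <;>
        exact h ((hend r).2 (by tauto))
  have hcard : S.card = k := by
    have h3 : g ∈ a.arcs.erase f := Finset.mem_erase.2 ⟨hfg.symm, hg⟩
    have h4 := Finset.card_erase_add_one hf
    have h5 := Finset.card_erase_add_one h3
    have h6 := a.card_arcs
    rw [Finset.card_insert_of_notMem, Finset.card_insert_of_notMem]
    · omega
    · simp [h2]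
    · simp [h1]; omega
  refine ⟨⟨S, hcard, ?_, ?_, ?_, ?_⟩, rfl, ?_, ?_⟩
  · intro e he
    rcases (hmem e).1 he with rfl | rfl | ⟨he, -⟩
    · exact ⟨(hrange p (by simp)).1, hpq, (hrange q (by simp)).2⟩
    · exact ⟨(hrange s (by simp)).1, hst, (hrange t (by simp)).2⟩
    · exact a.mem_range e he
  · intro e he e' he' hee
    rcases (hmem e).1 he with rfl | rfl | ⟨he, h3, h4⟩ <;>
      rcases (hmem e').1 he' with rfl | rfl | ⟨he', h5, h6⟩
    · exact absurd rfl hee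
    · grind
    · grind
    · grind
    · exact absurd rfl hee
    · grind
    · grind
    · grind
    · exact hd _ he _ he' hee
  · intro e he e' he'
    have := a.mem_range e
    have := a.mem_range e'
    rcases (hmem e).1 he with rfl | rfl | ⟨he, h3, h4⟩ <;>
      rcases (hmem e').1 he' with rfl | rfl | ⟨he', h5, h6⟩
    · grind
    · grind
    · grind
    · grind
    · grind
    · grind
    · grind
    · grind
    · exact a.noncross _ he _ he'
  · intro e he r hr1 hr2
    apply hcov
    rcases (hmem e).1 he with rfl | rfl | ⟨he, -⟩
    · exact cpq r hr1 hr2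
    · exact cst r hr1 hr2
    · exact a.no_ray_under e he r hr1 hr2
  · ext e
    simp only [Finset.mem_insert, Finset.mem_erase, hmem]
    grind
  · rintro i ⟨hi1, hi2, hi⟩
    have hno : ¬ ∃ e ∈ a.arcs, i = e.1 ∨ i = e.2 := by
      intro h
      obtain ⟨e, he, hr⟩ := hcov i h
      exact hr.elim (fun h => (hi e he).1 h.symm) fun h => (hi e he).2 h.symm
    exact ⟨hi1, hi2, fun e he => ⟨fun h => hno ⟨e, he, .inl h.symm⟩,
      fun h => hno ⟨e, he, .inr h.symm⟩⟩⟩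

/-- A ray at `v` and an arc `f` ending at `u` may be exchanged for a ray at `u` and an arc
`(p, q)` if the latter crosses nothing and the ray at `u` lies beneath no arc. -/
theorem exists_exchange_ray {n k : ℕ} (a : NCMatching n k) {p q u v : ℕ} {f : ℕ × ℕ}
    (hf : f ∈ a.arcs) (hv : a.IsRay v) (hpq : p < q) (hu : u ≠ p ∧ u ≠ q)
    (hvpq : v = p ∨ v = q)
    (hend : ∀ r, (r = p ∨ r = q ∨ r = u) ↔ (r = f.1 ∨ r = f.2 ∨ r = v))
    (hpq' : ∀ e ∈ a.arcs, e ≠ f → (p < e.1 ∧ e.1 < q ↔ p < e.2 ∧ e.2 < q))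
    (hu' : ∀ e ∈ a.arcs, e ≠ f → ¬ (e.1 < u ∧ u < e.2)) (hupq : ¬ (p < u ∧ u < q))
    (cpq : ∀ r, p < r → r < q → ∃ e ∈ a.arcs, r = e.1 ∨ r = e.2) :
    ∃ a' : NCMatching n k, a'.arcs = insert (p, q) (a.arcs.erase f) ∧
      a.arcs = insert f (a'.arcs.erase (p, q)) ∧ a'.IsRay u ∧
      ∀ i, a'.IsRay i → (a.IsRay i ∧ i ≠ v) ∨ i = u := by
  have hd := a.endpoints_distinct
  have hvr := hv.2.2
  have h1 : (p, q) ∉ a.arcs := by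
    intro h
    have := hvr _ h
    grind
  have hold : ∀ e ∈ a.arcs, e ≠ f → ∀ r, (r = p ∨ r = q ∨ r = u) → e.1 ≠ r ∧ e.2 ≠ r := by
    intro e he hef r hr
    have := hd _ he _ hf hef
    have := hvr _ he
    have := (hend r).1 hr
    grind
  have hrange : ∀ r, (r = p ∨ r = q ∨ r = u) → 1 ≤ r ∧ r ≤ n := by
    intro r hr
    have := a.mem_range _ hf
    have := hv.1
    have := hv.2.1
    have := (hend r).1 hr
    grind
  let S := insert (p, q) (a.arcs.erase f)
  have hmem : ∀ e, e ∈ S ↔ e = (p, q) ∨ (e ∈ a.arcs ∧ e ≠ f) := by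
    intro e
    simp only [S, Finset.mem_insert, Finset.mem_erase]
    tauto
  have hcov : ∀ r, r ≠ u → (∃ e ∈ a.arcs, r = e.1 ∨ r = e.2) → ∃ e ∈ S, r = e.1 ∨ r = e.2 := by
    rintro r hru ⟨e, he, hr⟩
    by_cases h : r = p ∨ r = q
    · exact ⟨(p, q), by simp [hmem], h⟩
    · refine ⟨e, (hmem e).2 (.inr ⟨he, ?_⟩), hr⟩
      rintro rfl
      have := (hend r).2 (by tauto)
      tauto
  have hcard : S.card = k := by
    have h4 := Finset.card_erase_add_one hf
    have h6 := a.card_arcs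
    rw [Finset.card_insert_of_notMem (by simp [h1])]
    omega
  refine ⟨⟨S, hcard, ?_, ?_, ?_, ?_⟩, rfl, ?_, ⟨(hrange u (by simp)).1, (hrange u (by simp)).2, ?_⟩,
    ?_⟩
  · intro e he
    rcases (hmem e).1 he with rfl | ⟨he, -⟩
    · exact ⟨(hrange p (by simp)).1, hpq, (hrange q (by simp)).2⟩
    · exact a.mem_range e he
  · intro e he e' he' hee
    rcases (hmem e).1 he with rfl | ⟨he, h3⟩ <;> rcases (hmem e').1 he' with rfl | ⟨he', h5⟩
    · exact absurd rfl hee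
    · grind
    · grind
    · exact hd _ he _ he' hee
  · intro e he e' he'
    have := a.mem_range e
    have := a.mem_range e'
    rcases (hmem e).1 he with rfl | ⟨he, h3⟩ <;> rcases (hmem e').1 he' with rfl | ⟨he', h5⟩
    · grind
    · grind
    · grind
    · exact a.noncross _ he _ he'
  · intro e he r hr1 hr2
    rcases (hmem e).1 he with rfl | ⟨he, hef⟩
    · exact hcov r (by grind) (cpq r hr1 hr2)
    · have := hu' e he hef
      exact hcov r (by grind) (a.no_ray_under e he r hr1 hr2)
  · ext e
    simp only [Finset.mem_insert, Finset.mem_erase, hmem]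
    grind
  · intro e he
    rcases (hmem e).1 he with rfl | ⟨he, hef⟩
    · grind
    · exact hold e he hef u (by simp)
  · rintro i ⟨hi1, hi2, hi⟩
    by_cases hiu : i = u
    · exact .inr hiu
    have hno : ¬ ∃ e ∈ a.arcs, i = e.1 ∨ i = e.2 := by
      intro h
      obtain ⟨e, he, hr⟩ := hcov i hiu h
      exact hr.elim (fun h => (hi e he).1 h.symm) fun h => (hi e he).2 h.symm
    refine .inl ⟨⟨hi1, hi2, fun e he => ⟨fun h => hno ⟨e, he, .inl h.symm⟩,
      fun h => hno ⟨e, he, .inr h.symm⟩⟩⟩, ?_⟩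
    · have := hi (p, q) ((hmem _).2 (.inl rfl))
      grind

/-- `a'` is obtained from `a` by one move, contains the arc `(p, q)`, and for every `b` with the
arc `(p, q)` the gluing of `a'` with `b` refines that of `a` with `b`: the component of `(p, q)`
is split, and the rays move within components. -/
def Surgery {n k : ℕ} (a a' : NCMatching n k) (p q : ℕ) : Prop :=
  (Move a a' ∨ Move a' a) ∧ (p, q) ∈ a'.arcs ∧
    (∃ z, 1 ≤ z ∧ z ≤ n ∧ z ≠ p ∧ z ≠ q ∧
      ∀ b : NCMatching n k, (p, q) ∈ b.arcs → Conn a b p z) ∧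
    (∀ b : NCMatching n k, (p, q) ∈ b.arcs → ∀ e ∈ a'.arcs, Conn a b e.1 e.2) ∧
    ∃ u v, (∀ b : NCMatching n k, (p, q) ∈ b.arcs → Conn a b u v) ∧
      ∀ i, a'.IsRay i → (a.IsRay i ∧ i ≠ v) ∨ (i = u ∧ a.IsRay v)

theorem exists_surgery {n k : ℕ} {a : NCMatching n k} {p q : ℕ} (hp : 1 ≤ p) (hpq : p < q)
    (hq : q ≤ n) (hnot : (p, q) ∉ a.arcs)
    (hcover : ∀ r, p < r → r < q → ∃ e ∈ a.arcs, (r = e.1 ∨ r = e.2) ∧ p < e.1 ∧ e.2 < q)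
    (hray : ¬ (a.IsRay p ∧ a.IsRay q)) : ∃ a' : NCMatching n k, Surgery a a' p q := by
  classical
  have hd := a.endpoints_distinct
  have hnc := a.noncross
  have hrg := a.mem_range
  have hin : ∀ e ∈ a.arcs, (p < e.1 ∧ e.1 < q ↔ p < e.2 ∧ e.2 < q) := by
    intro e he
    have := hrg e he
    constructor
    · rintro ⟨h1, h2⟩
      obtain ⟨e', he', h3, h4, h5⟩ := hcover _ h1 h2
      have := hd e he e' he'
      grind
    · rintro ⟨h1, h2⟩
      obtain ⟨e', he', h3, h4, h5⟩ := hcover _ h1 h2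
      have := hd e he e' he'
      grind
  have cpq : ∀ r, p < r → r < q → ∃ e ∈ a.arcs, r = e.1 ∨ r = e.2 := by
    intro r h1 h2
    obtain ⟨e, he, h, -⟩ := hcover r h1 h2
    exact ⟨e, he, h⟩
  have partner : ∀ r, 1 ≤ r → r ≤ n → a.IsRay r ∨ ∃ x, (r, x) ∈ a.arcs ∨ (x, r) ∈ a.arcs := by
    intro r h1 h2
    by_contra! hcon
    refine hcon.1 ⟨h1, h2, ?_⟩
    rintro ⟨s, t⟩ he
    have := hcon.2 s
    have := hcon.2 t
    grind
  have conn : ∀ (b : NCMatching n k) r x, (r, x) ∈ a.arcs ∨ (x, r) ∈ a.arcs → Conn a b r x :=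
    fun b r x h => h.elim conn_of_left fun h => (conn_of_left h).symm
  have range : ∀ r x, (r, x) ∈ a.arcs ∨ (x, r) ∈ a.arcs → 1 ≤ x ∧ x ≤ n := by
    rintro r x (h | h)
    · have := hrg _ h; grind
    · have := hrg _ h; grind
  have finish_arcs : ∀ (a' : NCMatching n k) (x y s t : ℕ) (f g : ℕ × ℕ),
      ((p, x) ∈ a.arcs ∨ (x, p) ∈ a.arcs) → ((q, y) ∈ a.arcs ∨ (y, q) ∈ a.arcs) →
      (x ≠ p ∧ x ≠ q) → ((s = x ∧ t = y) ∨ (s = y ∧ t = x)) → (Move a a' ∨ Move a' a) →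
      a'.arcs = insert (p, q) (insert (s, t) ((a.arcs.erase f).erase g)) →
      (∀ i, a'.IsRay i → a.IsRay i) → Surgery a a' p q := by
    intro a' x y s t f g hx hy hxp hst hm ha' hr
    refine ⟨hm, by simp [ha'], ⟨x, (range _ _ hx).1, (range _ _ hx).2, hxp.1, hxp.2,
      fun b _ => conn b _ _ hx⟩, fun b hb e he => ?_, p, p, fun _ _ => .refl, fun i hi => .inl
        ⟨hr i hi, ?_⟩⟩
    · rw [ha'] at he
      simp only [Finset.mem_insert, Finset.mem_erase] at he
      rcases he with rfl | rfl | he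
      · exact conn_of_right hb
      · have hxy : Conn a b x y :=
          (conn b _ _ hx).symm.trans ((conn_of_right hb).trans (conn b _ _ hy))
        rcases hst with ⟨rfl, rfl⟩ | ⟨rfl, rfl⟩
        exacts [hxy, hxy.symm]
      · exact conn_of_left he.2.2
    · rintro rfl
      exact (hi.2.2 (i, q) (by simp [ha'])).1 rfl
  have finish_ray : ∀ (a' : NCMatching n k) (u v w : ℕ) (f : ℕ × ℕ),
      (v = p ∧ w = q ∨ v = q ∧ w = p) → ((w, u) ∈ a.arcs ∨ (u, w) ∈ a.arcs) →
      (u ≠ p ∧ u ≠ q) → a.IsRay v → (Move a a' ∨ Move a' a) →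
      a'.arcs = insert (p, q) (a.arcs.erase f) →
      (∀ i, a'.IsRay i → (a.IsRay i ∧ i ≠ v) ∨ i = u) → Surgery a a' p q := by
    intro a' u v w f hvw hwu hup hv hm ha' hr
    have hc : ∀ b : NCMatching n k, (p, q) ∈ b.arcs → Conn a b p u ∧ Conn a b v u := by
      intro b hb
      have h1 := conn b _ _ hwu
      have h2 : Conn a b p q := conn_of_right hb
      rcases hvw with ⟨rfl, rfl⟩ | ⟨rfl, rfl⟩
      exacts [⟨h2.trans h1, h2.trans h1⟩, ⟨h1, h2.symm.trans h1⟩]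
    refine ⟨hm, by simp [ha'], ⟨u, (range _ _ hwu).1, (range _ _ hwu).2, hup.1, hup.2,
      fun b hb => (hc b hb).1⟩, fun b hb e he => ?_, u, v, fun b hb => (hc b hb).2.symm,
      fun i hi => (hr i hi).imp_right fun h => ⟨h, hv⟩⟩
    rw [ha'] at he
    simp only [Finset.mem_insert, Finset.mem_erase] at he
    rcases he with rfl | he
    · exact conn_of_right hb
    · exact conn_of_left he.2
  rcases partner p hp (by omega) with hpr | ⟨x, hx⟩ <;>
    rcases partner q (by omega) hq with hqr | ⟨y, hy⟩
  · exact absurd ⟨hpr, hqr⟩ hray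
  · have hyq : (q, y) ∈ a.arcs := by
      refine hy.resolve_right fun h => ?_
      have h1 := hpr.2.2 _ h
      have h2 := hin _ h
      have h3 := hrg _ h
      have h4 := a.no_ray_under _ h p
      have h5 := hpr.2.2
      grind
    have hqy := hrg _ hyq
    have hu : ∀ e ∈ a.arcs, e ≠ (q, y) → ¬ (e.1 < y ∧ y < e.2) := by
      intro e he hne h
      have h1 := hnc _ he _ hyq
      have h2 := hnc _ hyq _ he
      have h3 := hin _ he
      have h4 := a.no_ray_under _ he p
      have h5 := hpr.2.2
      have h6 := hd _ he _ hyq hne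
      grind
    simp only at hqy
    obtain ⟨a', h1, h2, h3, h4⟩ := exists_exchange_ray a (p := p) (q := q) (u := y) (v := p)
      (f := (q, y)) hyq hpr hpq (by omega) (.inl rfl) (by grind) (fun e he _ => hin e he) hu
      (by omega) cpq
    exact ⟨a', finish_ray a' y p q _ (.inl ⟨rfl, rfl⟩) hy (by omega) hpr
      (.inl (.inr ⟨p, q, y, hpq, by omega, hpr, hyq, h1⟩)) h1 h4⟩
  · have hxp : (x, p) ∈ a.arcs := by
      refine hx.resolve_left fun h => ?_
      have h1 := hqr.2.2 _ h
      have h2 := hin _ h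
      have h3 := hrg _ h
      have h4 := a.no_ray_under _ h q
      have h5 := hqr.2.2
      grind
    have hqy := hrg _ hxp
    have hu : ∀ e ∈ a.arcs, e ≠ (x, p) → ¬ (e.1 < x ∧ x < e.2) := by
      intro e he hne h
      have h1 := hnc _ he _ hxp
      have h2 := hnc _ hxp _ he
      have h3 := hin _ he
      have h4 := a.no_ray_under _ he q
      have h5 := hqr.2.2
      have h6 := hd _ he _ hxp hne
      grind
    simp only at hqy
    obtain ⟨a', h1, h2, h3, h4⟩ := exists_exchange_ray a (p := p) (q := q) (u := x) (v := q)
      (f := (x, p)) hxp hqr hpq (by omega) (.inr rfl) (by grind) (fun e he _ => hin e he) hu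
      (by omega) cpq
    exact ⟨a', finish_ray a' x q p _ (.inr ⟨rfl, rfl⟩) hx (by omega) hqr
      (.inr (.inr ⟨x, p, q, by omega, hpq, h3, by simp [h1], h2⟩)) h1 h4⟩
  · rcases hx with hx' | hx' <;> rcases hy with hy' | hy'
    · have h1 := hrg _ hx'
      have h2 := hrg _ hy'
      have h3 := hin _ hx'
      have h4 := hnc _ hx' _ hy'
      have h5 := hd _ hx' _ hy' (by grind)
      simp only at h1 h2 h3 h4 h5
      have hqx : q < x := by grind
      have hyx : y < x := by omega
      obtain ⟨a', h6, h7, h8⟩ := exists_exchange_arcs a (p := p) (q := q) (s := y) (t := x)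
        hx' hy' (by grind) hpq hyx (by omega) (by grind) (by grind) (by omega)
        (fun e he _ _ => hin e he)
        (by
          intro e he hef heg
          have := hnc _ he _ hx'
          have := hnc _ hx' _ he
          have := hnc _ he _ hy'
          have := hnc _ hy' _ he
          have := hrg _ he
          have := hd _ he _ hx' hef
          have := hd _ he _ hy' heg
          grind)
        cpq (fun r hr1 hr2 => a.no_ray_under _ hx' r (by simp only; omega) hr2)
      exact ⟨a', finish_arcs a' x y y x _ _ (.inl hx') (.inl hy') (by omega) (.inr ⟨rfl, rfl⟩)
        (.inr (.inl ⟨p, q, y, x, hpq, by omega, hyx, by simp [h6], by simp [h6], h7⟩)) h6 h8⟩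
    · exfalso
      have h1 := hrg _ hx'
      have h2 := hrg _ hy'
      have h3 := hin _ hx'
      have h4 := hin _ hy'
      have h5 := hnc _ hy' _ hx'
      have h6 := hd _ hx' _ hy'
      grind
    · have h1 := hrg _ hx'
      have h2 := hrg _ hy'
      simp only at h1 h2
      obtain ⟨a', h6, h7, h8⟩ := exists_exchange_arcs a (p := p) (q := q) (s := x) (t := y)
        hx' hy' (by grind) hpq (by omega) (by omega) (by grind) (by grind) (by omega)
        (fun e he _ _ => hin e he)
        (by
          intro e he hef heg
          have := hnc _ he _ hx'
          have := hnc _ hx' _ he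
          have := hnc _ he _ hy'
          have := hnc _ hy' _ he
          have := hrg _ he
          have := hin _ he
          have := hd _ he _ hx' hef
          have := hd _ he _ hy' heg
          grind)
        cpq
        (by
          intro r hr1 hr2
          rcases lt_trichotomy r p with h | rfl | h
          · exact a.no_ray_under _ hx' r hr1 h
          · exact ⟨_, hx', .inr rfl⟩
          rcases lt_trichotomy r q with h' | rfl | h'
          · exact cpq r h h'
          · exact ⟨_, hy', .inl rfl⟩
          · exact a.no_ray_under _ hy' r h' hr2)
      exact ⟨a', finish_arcs a' x y x y (x, p) (q, y) (.inr hx') (.inl hy') (by omega)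
        (.inl ⟨rfl, rfl⟩)
        (.inl (.inl ⟨x, p, q, y, by omega, hpq, by omega, hx', hy', by rw [h6, Finset.insert_comm]⟩))
        h6 h8⟩
    · have h1 := hrg _ hx'
      have h2 := hrg _ hy'
      have h3 := hin _ hy'
      have h4 := hnc _ hx' _ hy'
      have h5 := hd _ hx' _ hy' (by grind)
      simp only at h1 h2 h3 h4 h5
      have hyp : y < p := by grind
      have hyx : y < x := by omega
      obtain ⟨a', h6, h7, h8⟩ := exists_exchange_arcs a (p := p) (q := q) (s := y) (t := x)
        hx' hy' (by grind) hpq hyx (by omega) (by grind) (by grind) (by omega)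
        (fun e he _ _ => hin e he)
        (by
          intro e he hef heg
          have := hnc _ he _ hx'
          have := hnc _ hx' _ he
          have := hnc _ he _ hy'
          have := hnc _ hy' _ he
          have := hrg _ he
          have := hin _ he
          have := hd _ he _ hx' hef
          have := hd _ he _ hy' heg
          grind)
        cpq (fun r hr1 hr2 => a.no_ray_under _ hy' r hr1 (by simp only; omega))
      refine ⟨a', finish_arcs a' x y y x _ _ (.inr hx') (.inr hy') (by omega) (.inr ⟨rfl, rfl⟩)
        (.inr (.inl ⟨y, x, p, q, hyx, by omega, hpq, by simp [h6], by simp [h6], ?_⟩)) h6 h8⟩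
      rw [h7, Finset.insert_comm, Finset.erase_right_comm]

theorem exists_move_comps_lt {n k : ℕ} {a b : NCMatching n k} (hab : InBa a b)
    (hne : a.arcs ≠ b.arcs) :
    ∃ a' : NCMatching n k, (Move a a' ∨ Move a' a) ∧ InBa a' b ∧ comps a b < comps a' b := by
  classical
  have hex : (b.arcs \ a.arcs).Nonempty := by
    rw [Finset.sdiff_nonempty]
    exact fun h => hne (Finset.eq_of_subset_of_card_le h (by rw [a.card_arcs, b.card_arcs])).symm
  obtain ⟨⟨p, q⟩, hpq, hmin⟩ := Finset.exists_min_image _ (fun e : ℕ × ℕ => e.2 - e.1) hex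
  obtain ⟨hb, ha⟩ := Finset.mem_sdiff.1 hpq
  have hr := b.mem_range _ hb
  simp only at hr hmin
  obtain ⟨a', hmove, hpa', ⟨z, hz1, hzn, hzp, hzq, hz⟩, hconn, u, v, huv, hrays⟩ :=
    exists_surgery hr.1 hr.2.1 hr.2.2 ha
      (by
        intro r h1 h2
        obtain ⟨⟨s, t⟩, he, hrs⟩ := b.no_ray_under _ hb r h1 h2
        have h3 := b.noncross _ hb _ he
        have h4 := b.noncross _ he _ hb
        have h5 := b.endpoints_distinct _ hb _ he
        have h6 := b.mem_range _ he
        have h7 := hmin (s, t)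
        refine ⟨(s, t), ?_, hrs, ?_⟩ <;> grind)
      (fun h => hab.1 p q h.1 h.2 (by omega) (conn_of_right hb))
  have hglue : ∀ i j, glueRel a' b i j → Conn a b i j := by
    rintro i j (h | h | h | h)
    exacts [hconn b hb _ h, (hconn b hb _ h).symm, conn_of_right h, (conn_of_right h).symm]
  have hle : ∀ i j, Conn a' b i j → Conn a b i j := by
    intro i j h
    induction h with
    | refl => exact .refl
    | tail _ h ih => exact ih.trans (hglue _ _ h)
  refine ⟨a', hmove, ⟨fun i j hi hj hij h => ?_, fun i j hi hj hij h =>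
    hab.2 i j hi hj hij (hle _ _ h)⟩, ?_⟩
  · rcases hrays i hi with ⟨hi', hiv⟩ | ⟨rfl, hv⟩ <;> rcases hrays j hj with ⟨hj', hjv⟩ | ⟨rfl, hv'⟩
    · exact hab.1 i j hi' hj' hij (hle _ _ h)
    · exact hab.1 i v hi' hv' hiv ((hle _ _ h).trans (huv b hb))
    · exact hab.1 v j hv hj' (Ne.symm hjv) ((huv b hb).symm.trans (hle _ _ h))
    · exact hij rfl
  · refine card_quot_lt_of_refines (u := (⟨p - 1, by omega⟩ : Fin n)) (v := ⟨z - 1, by omega⟩)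
      (fun i j h => quot_mk_eq_of_conn (hglue _ _ h)) (quot_mk_eq_of_conn ?_) fun h => ?_
    · have h1 : p - 1 + 1 = p := by omega
      have h2 : z - 1 + 1 = z := by omega
      simpa only [h1, h2] using hz b hb
    · let P : Quot (glueRelF a' b) → Prop := Quot.lift
        (fun w : Fin n => (w : ℕ) + 1 = p ∨ (w : ℕ) + 1 = q) (by
          intro i j hij
          have key : ∀ c : NCMatching n k, (p, q) ∈ c.arcs → ∀ s t, (s, t) ∈ c.arcs →
              ((s = p ∨ s = q) ↔ (t = p ∨ t = q)) := by
            intro c hc s t hst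
            have h1 := c.endpoints_distinct _ hc _ hst
            grind
          apply propext
          rcases hij with h | h | h | h
          exacts [key a' hpa' _ _ h, (key a' hpa' _ _ h).symm, key b hb _ _ h,
            (key b hb _ _ h).symm])
      have h1 : P (Quot.mk _ ⟨p - 1, by omega⟩) := Or.inl (by simp; omega)
      rw [h] at h1
      rcases h1 with h1 | h1 <;> simp only at h1 <;> omega

theorem exists_isMoveSeq {n k : ℕ} {a b : NCMatching n k} (hab : InBa a b) :
    ∃ d, d + comps a b + k ≤ n ∧
      ∃ f : Fin (d + 1) → NCMatching n k, f 0 = a ∧ f (Fin.last d) = b ∧ IsMoveSeq f := by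
  induction hN : n - comps a b using Nat.strong_induction_on generalizing a with
  | _ N ih =>
    by_cases h : a.arcs = b.arcs
    · obtain rfl : a = b := by cases a; cases b; simpa using h
      exact ⟨0, by simpa using comps_add_le a a, fun _ => a, rfl, rfl, fun i => i.elim0⟩
    · obtain ⟨a', hm, hB, hlt⟩ := exists_move_comps_lt hab h
      have hle := comps_add_le a' b
      obtain ⟨d, hd, f, h0, hlast, hf⟩ := ih _ (by omega) hB rfl
      refine ⟨d + 1, by omega, Fin.cons a f, rfl, by rw [← Fin.succ_last, Fin.cons_succ, hlast],
        fun i => ?_⟩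
      cases i using Fin.cases with
      | zero => simpa [h0] using hm
      | succ i => simpa [← Fin.succ_castSucc] using hf i

/-- For noncrossing matchings `a` of type `(n-k,k)` and `b ∈ B_a^{n-k,k}`, the distance
satisfies `d(a,b) = (n-k) - |a w(b)|`, where `|a w(b)|` counts all connected components
(circles and lines) of the glued one-manifold. -/
theorem dist_eq_nk_sub_comps (n k : ℕ) (hk : 2 * k ≤ n)
    (a b : NCMatching n k) (hab : InBa a b) :
    mdist a b + comps a b = n - k := by
  obtain ⟨d, hd, hmem⟩ := exists_isMoveSeq hab
  have hle : mdist a b ≤ d := Nat.sInf_le hmem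
  obtain ⟨f, h0, hlast, hf⟩ := Nat.sInf_mem (s := {d : ℕ | ∃ f : Fin (d + 1) → NCMatching n k,
    f 0 = a ∧ f (Fin.last d) = b ∧ IsMoveSeq f}) ⟨d, hmem⟩
  have hge := le_add_comps_of_isMoveSeq hf
  rw [h0, hlast] at hge
  change n ≤ mdist a b + comps a b + k at hge
  omega
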